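/- Let p, q ∈ D be weakly comaximal. If p(u) ≥ 0 for every u ∈ ℝ, or q(u) ≥ 0 for every u ∈ ℝ, then the matrix [[p, q], [0, 0]] ∈ M₂(D) is a product of idempotent matrices over D. -/

import Mathlib

/-- The minimal Dress ring of `ℝ(X)`: the smallest subring of `RatFunc ℝ` containing
every element of the form `1/(1+x²)`. -/
noncomputable def DressD : Subring (RatFunc ℝ) :=
  Subring.closure {z : RatFunc ℝ | ∃ x : RatFunc ℝ, z = (1 + x ^ 2)⁻¹}

/-- Evaluation at a real number of an element of the Dress ring. -/
noncomputable def evalD (p : DressD) (u : ℝ) : ℝ :=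
  RatFunc.eval (RingHom.id ℝ) u (p : RatFunc ℝ)

/-- A `2 × 2` matrix is a product of idempotent matrices if it is the product of a
finite list of idempotent matrices. -/
def IsProductOfIdempotents {R : Type*} [CommRing R] (A : Matrix (Fin 2) (Fin 2) R) : Prop :=
  ∃ L : List (Matrix (Fin 2) (Fin 2) R), (∀ T ∈ L, IsIdempotentElem T) ∧ L.prod = A

open Polynomial

section ProductOfIdempotents

variable {R : Type*} [CommRing R]

theorem IsIdempotentElem.isProductOfIdempotents {A : Matrix (Fin 2) (Fin 2) R}
    (hA : IsIdempotentElem A) : IsProductOfIdempotents A :=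
  ⟨[A], by simpa using hA, by simp⟩

theorem IsProductOfIdempotents.mul {A B : Matrix (Fin 2) (Fin 2) R}
    (hA : IsProductOfIdempotents A) (hB : IsProductOfIdempotents B) :
    IsProductOfIdempotents (A * B) := by
  obtain ⟨L, hL, rfl⟩ := hA
  obtain ⟨M, hM, rfl⟩ := hB
  refine ⟨L ++ M, fun T hT => ?_, by simp⟩
  rcases List.mem_append.1 hT with h | h
  exacts [hL T h, hM T h]

theorem IsProductOfIdempotents.conj {A P Q : Matrix (Fin 2) (Fin 2) R}
    (hA : IsProductOfIdempotents A) (hPQ : P * Q = 1) :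
    IsProductOfIdempotents (Q * A * P) := by
  have hQP : Q * P = 1 := mul_eq_one_comm.1 hPQ
  obtain ⟨L, hL, rfl⟩ := hA
  induction L with
  | nil => exact ⟨[], by simp, by simp [hQP]⟩
  | cons T L ih =>
    have h : Q * (T :: L).prod * P = (Q * T * P) * (Q * L.prod * P) := by
      rw [List.prod_cons]
      calc Q * (T * L.prod) * P = Q * T * 1 * L.prod * P := by simp only [mul_assoc, one_mul]
        _ = _ := by rw [← hPQ]; simp only [mul_assoc]
    rw [h]
    refine IsProductOfIdempotents.mul ?_ (ih fun S hS => hL S (List.mem_cons_of_mem _ hS))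
    refine IsIdempotentElem.isProductOfIdempotents ?_
    have hT : T * T = T := hL T List.mem_cons_self
    calc Q * T * P * (Q * T * P) = Q * T * (P * Q) * (T * P) := by simp only [mul_assoc]
      _ = Q * (T * T) * P := by rw [hPQ, mul_one]; simp only [mul_assoc]
      _ = Q * T * P := by rw [hT]

theorem isProductOfIdempotents_one_row (b : R) :
    IsProductOfIdempotents !![1, b; 0, 0] :=
  IsIdempotentElem.isProductOfIdempotents <| by
    ext i j
    fin_cases i <;> fin_cases j <;> simp

theorem IsProductOfIdempotents.row_swap {a b : R}
    (h : IsProductOfIdempotents !![a, b; 0, 0]) : IsProductOfIdempotents !![b, a; 0, 0] := by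
  have h1 := h.conj (P := !![0, 1; 1, 0]) (Q := !![0, 1; 1, 0]) (by simp [Matrix.one_fin_two])
  convert (isProductOfIdempotents_one_row (1 : R)).mul h1 using 1
  simp

theorem IsProductOfIdempotents.row_add_right {a b : R}
    (h : IsProductOfIdempotents !![a, b; 0, 0]) (t : R) :
    IsProductOfIdempotents !![a, b + t * a; 0, 0] := by
  convert h.conj (P := !![1, t; 0, 1]) (Q := !![1, -t; 0, 1]) (by simp [Matrix.one_fin_two]) using 1
  simp [mul_comm, add_comm]

theorem IsProductOfIdempotents.row_add_left {a b : R}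
    (h : IsProductOfIdempotents !![a, b; 0, 0]) (t : R) :
    IsProductOfIdempotents !![a + t * b, b; 0, 0] :=
  (h.row_swap.row_add_right t).row_swap

theorem isProductOfIdempotents_scalar_row (s : R) :
    IsProductOfIdempotents !![s, 0; 0, 0] := by
  convert (isProductOfIdempotents_one_row (s - 1)).mul
    (IsIdempotentElem.isProductOfIdempotents (A := !![1, 0; 1, 0]) (by simp [IsIdempotentElem]))
    using 1
  simp

theorem IsProductOfIdempotents.row_smul {a b : R}
    (h : IsProductOfIdempotents !![a, b; 0, 0]) (s : R) :
    IsProductOfIdempotents !![s * a, s * b; 0, 0] := by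
  convert (isProductOfIdempotents_scalar_row s).mul h using 1
  simp

theorem isProductOfIdempotents_unit_row {v v' : R} (hv : v * v' = 1) (b : R) :
    IsProductOfIdempotents !![v, b; 0, 0] := by
  have h := (isProductOfIdempotents_one_row (v' * b)).row_smul v
  rwa [← mul_assoc, hv, mul_one, one_mul] at h

/-- The row of a matrix `!![w, y; y, 1 - w]` of determinant zero, after rescaling. -/
theorem isProductOfIdempotents_unit_mul_row {v v' c c' w y : R} (hv : v * v' = 1)
    (hc : c * c' = 1) (hwy : w * (1 - w) = y * y) :
    IsProductOfIdempotents !![v * w, c * y; 0, 0] := by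
  have hT : IsIdempotentElem !![w, v' * c * y; v * c' * y, 1 - w] := by
    have e : v' * c * (v * c') = 1 := by linear_combination hc + c * c' * hv
    rw [IsIdempotentElem, Matrix.mul_fin_two]
    congr 1
    ext i j
    fin_cases i <;> fin_cases j <;> simp
    · linear_combination (y * y) * e - hwy
    · ring
    · ring
    · linear_combination (y * y) * e - hwy
  convert (isProductOfIdempotents_scalar_row v).mul hT.isProductOfIdempotents using 1
  simp only [Matrix.mul_fin_two]
  congr 1
  ext i j
  fin_cases i <;> fin_cases j <;> simp
  linear_combination (-(c * y)) * hv

end ProductOfIdempotents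

section RealPolynomials

theorem Polynomial.leadingCoeff_nonneg_of_eval_nonneg {f : ℝ[X]} (hf : ∀ u, 0 ≤ f.eval u) :
    0 ≤ f.leadingCoeff := by
  by_contra! h
  rcases Nat.eq_zero_or_pos f.natDegree with h0 | h0
  · rw [eq_C_of_natDegree_eq_zero h0] at h hf
    have := hf 0
    simp at h this
    linarith
  · have := (f.tendsto_atBot_of_leadingCoeff_nonpos (natDegree_pos_iff_degree_pos.1 h0)
      h.le).eventually_lt_atBot 0
    obtain ⟨u, hu⟩ := this.exists
    exact absurd (hf u) (not_le.2 hu)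

theorem Polynomial.even_natDegree_of_eval_nonneg {f : ℝ[X]} (hf : ∀ u, 0 ≤ f.eval u) :
    Even f.natDegree := by
  by_contra h
  rw [Nat.not_even_iff_odd] at h
  have h1 := leadingCoeff_nonneg_of_eval_nonneg hf
  have h2 : 0 ≤ (f.comp (-X)).leadingCoeff :=
    leadingCoeff_nonneg_of_eval_nonneg fun u => by simpa using hf (-u)
  rw [comp_neg_X_leadingCoeff_eq, h.neg_one_pow] at h2
  have h3 : f = 0 := leadingCoeff_eq_zero.1 (by linarith)
  simp [h3] at h

theorem Polynomial.coeff_nonneg_of_eval_nonneg {f : ℝ[X]} (hf : ∀ u, 0 ≤ f.eval u) {n : ℕ}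
    (hn : f.natDegree ≤ n) : 0 ≤ f.coeff n := by
  rcases hn.eq_or_lt with h | h
  · rw [← h]; exact leadingCoeff_nonneg_of_eval_nonneg hf
  · rw [coeff_eq_zero_of_natDegree_lt h]

theorem Polynomial.natDegree_le_of_coeff_succ_eq_zero {f : ℝ[X]} {n : ℕ} (hf : f.natDegree ≤ n + 1)
    (h : f.coeff (n + 1) = 0) : f.natDegree ≤ n := by
  by_contra! hlt
  have h1 : f.natDegree = n + 1 := by omega
  rw [← h1, coeff_natDegree, leadingCoeff_eq_zero] at h
  simp [h] at h1

theorem natDegree_one_add_X_sq_pow (d : ℕ) : ((1 + X ^ 2 : ℝ[X]) ^ d).natDegree = 2 * d := by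
  rw [natDegree_pow, show (1 + X ^ 2 : ℝ[X]).natDegree = 2 by compute_degree!, mul_comm]

theorem coeff_one_add_X_sq_pow (d : ℕ) : ((1 + X ^ 2 : ℝ[X]) ^ d).coeff (2 * d) = 1 := by
  have h : (1 + X ^ 2 : ℝ[X]).natDegree ≤ 2 := by compute_degree!
  rw [mul_comm, coeff_pow_of_natDegree_le h]
  simp [coeff_one]

theorem eval_one_add_X_sq_pow_pos (d : ℕ) (u : ℝ) : 0 < ((1 + X ^ 2 : ℝ[X]) ^ d).eval u := by
  simp only [eval_pow, eval_add, eval_one, eval_X]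
  positivity

end RealPolynomials

section DressRing

local notation "φ" => algebraMap ℝ[X] (RatFunc ℝ)

theorem inv_one_add_sq_mem_DressD (x : RatFunc ℝ) : (1 + x ^ 2)⁻¹ ∈ DressD :=
  Subring.subset_closure ⟨x, rfl⟩

theorem C_mem_DressD (c : ℝ) : φ (C c) ∈ DressD := by
  have unit_interval : ∀ c : ℝ, 0 < c → c ≤ 1 → φ (C c) ∈ DressD := by
    intro c h0 h1
    have e : φ (C c) = (1 + φ (C (√(c⁻¹ - 1))) ^ 2)⁻¹ := by
      have h2 : 0 ≤ c⁻¹ - 1 := by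
        have := (one_le_inv₀ h0).2 h1
        linarith
      rw [← map_pow, ← map_pow, Real.sq_sqrt h2, ← map_one φ, ← map_add, ← C_1, ← C_add,
        add_sub_cancel]
      refine eq_inv_of_mul_eq_one_left ?_
      rw [← map_mul, ← C_mul, mul_inv_cancel₀ h0.ne']
      simp
    rw [e]
    exact inv_one_add_sq_mem_DressD _
  have pos : ∀ c : ℝ, 0 < c → φ (C c) ∈ DressD := by
    intro c h0
    obtain ⟨n, hn⟩ := exists_nat_ge c
    have hn0 : (0 : ℝ) < n := h0.trans_le hn
    have e : φ (C c) = (n : RatFunc ℝ) * φ (C (c / n)) := by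
      rw [← map_natCast φ, ← map_mul, ← C_eq_natCast, ← C_mul, mul_div_cancel₀ _ hn0.ne']
    rw [e]
    exact mul_mem (natCast_mem _ _) (unit_interval _ (by positivity) ((div_le_one hn0).2 hn))
  rcases lt_trichotomy c 0 with h | rfl | h
  · have := neg_mem (pos (-c) (by linarith))
    simpa using this
  · simp [zero_mem]
  · exact pos c h

theorem div_one_add_sq_mem_DressD (y : RatFunc ℝ) : y / (1 + y ^ 2) ∈ DressD := by
  have half : (1 / 2 : RatFunc ℝ) ∈ DressD := by
    have := inv_one_add_sq_mem_DressD 1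
    norm_num at this ⊢
    exact this
  by_cases h0 : 1 + y ^ 2 = 0
  · simp [h0, zero_mem]
  by_cases h1 : 1 - y = 0
  · rw [← sub_eq_zero.1 h1]
    norm_num at half ⊢
    exact half
  · have e : y / (1 + y ^ 2) = 1 / 2 - (1 + ((1 + y) / (1 - y)) ^ 2)⁻¹ := by
      have e1 : 1 + ((1 + y) / (1 - y)) ^ 2 = 2 * (1 + y ^ 2) / (1 - y) ^ 2 := by
        field_simp
        ring
      rw [e1, inv_div]
      field_simp
      ring
    rw [e]
    exact sub_mem half (inv_one_add_sq_mem_DressD _)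

theorem sq_div_one_add_sq_mem_DressD (y : RatFunc ℝ) : y ^ 2 / (1 + y ^ 2) ∈ DressD := by
  by_cases h0 : 1 + y ^ 2 = 0
  · simp [h0, zero_mem]
  · have e : y ^ 2 / (1 + y ^ 2) = 1 - (1 + y ^ 2)⁻¹ := by
      field_simp
      ring
    rw [e]
    exact sub_mem (one_mem _) (inv_one_add_sq_mem_DressD y)

theorem X_pow_div_quadratic_mem_DressD {a b c : ℝ} (ha : a ≠ 0) (hb : b ≠ 0) {i : ℕ} (hi : i ≤ 2) :
    φ X ^ i / φ (C a * ((X - C b * C c) ^ 2 + C b ^ 2)) ∈ DressD := by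
  have inj : ∀ r : ℝ, r ≠ 0 → φ (C r) ≠ 0 := fun r hr => by simpa using hr
  have hA := inj a ha
  have hB := inj b hb
  set y : RatFunc ℝ := φ X / φ (C b) - φ (C c) with hy
  have hX : φ X = φ (C b) * (y + φ (C c)) := by rw [hy]; field_simp; ring
  have hden : φ (C a * ((X - C b * C c) ^ 2 + C b ^ 2)) =
      φ (C a) * φ (C b) ^ 2 * (1 + y ^ 2) := by
    simp only [map_mul, map_add, map_sub, map_pow]
    rw [hX]
    ring
  have hC : ∀ r : ℝ, (φ (C r))⁻¹ = φ (C r⁻¹) := fun r => by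
    by_cases hr : r = 0
    · simp [hr]
    · refine inv_eq_of_mul_eq_one_right ?_
      rw [← map_mul, ← C_mul, mul_inv_cancel₀ hr]
      simp
  have key : φ X ^ i * (1 + y ^ 2)⁻¹ ∈ DressD := by
    rw [hX]
    have m1 := inv_one_add_sq_mem_DressD y
    have m2 := div_one_add_sq_mem_DressD y
    have m3 := sq_div_one_add_sq_mem_DressD y
    have mb := C_mem_DressD b
    have mc := C_mem_DressD c
    rw [div_eq_mul_inv] at m2 m3
    generalize (1 + y ^ 2)⁻¹ = z at *
    interval_cases i
    · simpa using m1
    · have e : (φ (C b) * (y + φ (C c))) ^ 1 * z =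
          φ (C b) * (y * z + φ (C c) * z) := by ring
      rw [e]
      exact mul_mem mb (add_mem m2 (mul_mem mc m1))
    · have e : (φ (C b) * (y + φ (C c))) ^ 2 * z =
          φ (C b) ^ 2 * (y ^ 2 * z + φ (C c) * (y * z) + φ (C c) * (y * z)
            + φ (C c) ^ 2 * z) := by ring
      rw [e]
      exact mul_mem (pow_mem mb 2) (add_mem (add_mem (add_mem m3 (mul_mem mc m2)) (mul_mem mc m2))
        (mul_mem (pow_mem mc 2) m1))
  have e : φ X ^ i / φ (C a * ((X - C b * C c) ^ 2 + C b ^ 2)) =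
      φ (C a⁻¹) * φ (C b⁻¹) ^ 2 * (φ X ^ i * (1 + y ^ 2)⁻¹) := by
    rw [hden, ← hC, ← hC, div_eq_mul_inv, mul_inv, mul_inv, inv_pow]
    ring
  rw [e]
  exact mul_mem (mul_mem (C_mem_DressD _) (pow_mem (C_mem_DressD _) 2)) key

theorem Polynomial.exists_eq_of_irreducible_of_eval_ne_zero {p : ℝ[X]} (hp : Irreducible p)
    (h : ∀ u, p.eval u ≠ 0) :
    ∃ a b c : ℝ, a ≠ 0 ∧ b ≠ 0 ∧ p = C a * ((X - C b * C c) ^ 2 + C b ^ 2) := by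
  have hdeg := hp.degree_le_two
  have hq := eq_quadratic_of_degree_le_two hdeg
  set a := p.coeff 2
  set b := p.coeff 1
  set c := p.coeff 0
  have heval : ∀ u, p.eval u = a * u ^ 2 + b * u + c := fun u => by rw [hq]; simp
  have ha : a ≠ 0 := by
    intro ha
    by_cases hb : b = 0
    · refine hp.not_isUnit ?_
      have hc : c ≠ 0 := by simpa [heval, ha, hb] using h 0
      rw [hq, ha, hb]
      simpa using hc
    · refine h (-c / b) ?_
      rw [heval, ha]
      field_simp
      ring
  have hdisc : b ^ 2 - 4 * a * c < 0 := by
    by_contra! hd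
    obtain ⟨u, hu⟩ := exists_quadratic_eq_zero (a := a) (b := b) (c := c) ha
      ⟨√(b ^ 2 - 4 * a * c), by rw [Real.mul_self_sqrt hd, discrim]⟩
    exact h u (by rw [heval, ← hu]; ring)
  have hs : 0 < (4 * a * c - b ^ 2) / (4 * a ^ 2) :=
    div_pos (by linarith) (by positivity)
  set s := √((4 * a * c - b ^ 2) / (4 * a ^ 2)) with hs_def
  have hs0 : s ≠ 0 := (Real.sqrt_pos.2 hs).ne'
  have hs2 : s ^ 2 = (4 * a * c - b ^ 2) / (4 * a ^ 2) := Real.sq_sqrt hs.le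
  refine ⟨a, s, -b / (2 * a) / s, ha, hs0, Polynomial.funext fun u => ?_⟩
  rw [heval]
  simp only [eval_mul, eval_add, eval_pow, eval_sub, eval_X, eval_C]
  rw [hs2, mul_div_cancel₀ _ hs0]
  field_simp
  ring

theorem X_pow_div_mem_DressD (γ : ℝ[X]) (hγ : ∀ u, γ.eval u ≠ 0) (i : ℕ) (hi : i ≤ γ.natDegree) :
    φ X ^ i / φ γ ∈ DressD := by
  induction γ using UniqueFactorizationMonoid.induction_on_prime generalizing i with
  | h₁ => simp at hγ
  | h₂ γ hu =>
    obtain ⟨r, hr, rfl⟩ := Polynomial.isUnit_iff.1 hu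
    simp only [natDegree_C, Nat.le_zero] at hi
    subst hi
    rw [pow_zero, one_div]
    convert C_mem_DressD r⁻¹ using 1
    refine inv_eq_of_mul_eq_one_right ?_
    rw [← map_mul, ← C_mul, mul_inv_cancel₀ hr.ne_zero]
    simp
  | h₃ γ p hγ0 hp ih =>
    simp only [eval_mul, mul_ne_zero_iff] at hγ
    obtain ⟨a, b, c, ha, hb, hpe⟩ :=
      exists_eq_of_irreducible_of_eval_ne_zero hp.irreducible fun u => (hγ u).1
    rw [natDegree_mul hp.ne_zero hγ0] at hi
    have hp2 : p.natDegree ≤ 2 := natDegree_le_of_degree_le hp.irreducible.degree_le_two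
    have e : φ X ^ i / φ (p * γ) =
        (φ X ^ (min i 2) / φ p) * (φ X ^ (i - 2) / φ γ) := by
      rw [map_mul, div_mul_div_comm, ← pow_add]
      congr 2
      omega
    rw [e]
    refine mul_mem ?_ (ih (fun u => (hγ u).2) _ (by omega))
    rw [hpe]
    exact X_pow_div_quadratic_mem_DressD ha hb (by omega)

theorem div_mem_DressD {f γ : ℝ[X]} (hγ : ∀ u, γ.eval u ≠ 0) (hf : f.natDegree ≤ γ.natDegree) :
    φ f / φ γ ∈ DressD := by
  have e : φ f / φ γ = ∑ i ∈ Finset.range (f.natDegree + 1),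
      φ (C (f.coeff i)) * (φ X ^ i / φ γ) := by
    conv_lhs => rw [f.as_sum_range_C_mul_X_pow]
    rw [map_sum, Finset.sum_div]
    refine Finset.sum_congr rfl fun i _ => ?_
    rw [map_mul, map_pow, mul_div_assoc]
  rw [e]
  refine sum_mem fun i hi => mul_mem (C_mem_DressD _) (X_pow_div_mem_DressD γ hγ i ?_)
  have := Finset.mem_range.1 hi
  omega

theorem ne_zero_of_eval_pos {γ : ℝ[X]} (hγ : ∀ u, 0 < γ.eval u) : γ ≠ 0 := by
  rintro rfl
  simpa using hγ 0

theorem map_ne_zero_of_eval_pos {γ : ℝ[X]} (hγ : ∀ u, 0 < γ.eval u) : φ γ ≠ 0 := by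
  simpa using ne_zero_of_eval_pos hγ

theorem exists_eq_div_of_mem_DressD {z : RatFunc ℝ} (hz : z ∈ DressD) :
    ∃ f γ : ℝ[X], (∀ u, 0 < γ.eval u) ∧ f.natDegree ≤ γ.natDegree ∧ z = φ f / φ γ := by
  induction hz using Subring.closure_induction with
  | mem z hz =>
    obtain ⟨x, rfl⟩ := hz
    set a := x.num
    set b := x.denom
    have hb : b ≠ 0 := x.denom_ne_zero
    have hpos : ∀ u, 0 < (b ^ 2 + a ^ 2).eval u := by
      intro u
      simp only [eval_add, eval_pow]
      by_contra! hle
      have h1 : b.eval u = 0 := by nlinarith [sq_nonneg (a.eval u), sq_nonneg (b.eval u)]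
      have h2 : a.eval u = 0 := by nlinarith [sq_nonneg (a.eval u), sq_nonneg (b.eval u)]
      obtain ⟨s, t, hst⟩ := x.isCoprime_num_denom
      have := congrArg (eval u) hst
      simp only [eval_add, eval_mul, eval_one] at this
      change _ * eval u a + _ * eval u b = 1 at this
      simp [h1, h2] at this
    refine ⟨b ^ 2, b ^ 2 + a ^ 2, hpos, ?_, ?_⟩
    · rw [natDegree_pow]
      by_contra! hlt
      have hc := coeff_eq_zero_of_natDegree_lt hlt
      have hc1 : (b ^ 2).coeff (2 * b.natDegree) = b.leadingCoeff ^ 2 :=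
        coeff_pow_of_natDegree_le le_rfl
      have hle : (a ^ 2).natDegree ≤ 2 * b.natDegree := by
        by_contra! h
        have : (b ^ 2 + a ^ 2).natDegree = (a ^ 2).natDegree :=
          natDegree_add_eq_right_of_natDegree_lt (by rwa [natDegree_pow])
        omega
      have hc2 : 0 ≤ (a ^ 2).coeff (2 * b.natDegree) :=
        coeff_nonneg_of_eval_nonneg (fun u => by rw [eval_pow]; positivity) hle
      rw [coeff_add, hc1] at hc
      have : 0 < b.leadingCoeff ^ 2 := pow_pos (by
        rw [show b.leadingCoeff = 1 from x.monic_denom]; exact one_pos) 2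
      linarith
    · have hx : x = φ a / φ b := x.num_div_denom.symm
      have hb' : φ b ≠ 0 := by simpa using hb
      have hne := map_ne_zero_of_eval_pos hpos
      rw [map_add, map_pow, map_pow] at hne ⊢
      rw [hx]
      have e1 : 1 + (φ a / φ b) ^ 2 = (φ b ^ 2 + φ a ^ 2) / φ b ^ 2 := by
        field_simp
      rw [e1, inv_div]
  | zero => exact ⟨0, 1, by simp, by simp, by simp⟩
  | one => exact ⟨1, 1, by simp, by simp, by simp⟩
  | add x y _ _ hx hy =>
    obtain ⟨f, γ, hγ, hf, rfl⟩ := hx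
    obtain ⟨g, δ, hδ, hg, rfl⟩ := hy
    have h1 := map_ne_zero_of_eval_pos hγ
    have h2 := map_ne_zero_of_eval_pos hδ
    refine ⟨f * δ + γ * g, γ * δ, fun u => by rw [eval_mul]; exact mul_pos (hγ u) (hδ u), ?_, ?_⟩
    · rw [natDegree_mul (ne_zero_of_eval_pos hγ) (ne_zero_of_eval_pos hδ)]
      refine natDegree_add_le_of_degree_le (natDegree_mul_le.trans ?_)
        (natDegree_mul_le.trans ?_) <;> omega
    · rw [map_add, map_mul, map_mul, map_mul, div_add_div _ _ h1 h2]
  | neg x _ hx =>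
    obtain ⟨f, γ, hγ, hf, rfl⟩ := hx
    exact ⟨-f, γ, hγ, by rwa [natDegree_neg], by rw [map_neg, neg_div]⟩
  | mul x y _ _ hx hy =>
    obtain ⟨f, γ, hγ, hf, rfl⟩ := hx
    obtain ⟨g, δ, hδ, hg, rfl⟩ := hy
    refine ⟨f * g, γ * δ, fun u => by rw [eval_mul]; exact mul_pos (hγ u) (hδ u), ?_, ?_⟩
    · rw [natDegree_mul (ne_zero_of_eval_pos hγ) (ne_zero_of_eval_pos hδ)]
      exact natDegree_mul_le.trans (add_le_add hf hg)
    · rw [map_mul, map_mul, div_mul_div_comm]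

theorem evalD_mul_eval {p : DressD} {f γ : ℝ[X]} (hγ : ∀ u, 0 < γ.eval u)
    (hp : (p : RatFunc ℝ) = φ f / φ γ) (u : ℝ) : evalD p u * γ.eval u = f.eval u := by
  have h1 : (p : RatFunc ℝ) * φ γ = φ f := by
    rw [hp, div_mul_cancel₀ _ (map_ne_zero_of_eval_pos hγ)]
  have h2 := congrArg (RatFunc.eval (RingHom.id ℝ) u) h1
  rw [RatFunc.eval_mul] at h2
  · simpa [evalD, RatFunc.eval_algebraMap, eval₂_id] using h2
  · intro h0
    obtain ⟨s, hs⟩ : (p : RatFunc ℝ).denom ∣ γ := by rw [hp]; exact RatFunc.denom_div_dvd _ _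
    have := hγ u
    rw [hs, eval_mul, ← eval₂_id, h0] at this
    simp at this
  · rw [RatFunc.denom_algebraMap]
    simp

/-- A quotient of positive real polynomials of the same degree is a unit of the Dress ring. -/
theorem exists_unit_of_natDegree_eq {f γ : ℝ[X]} (hf : ∀ u, 0 < f.eval u)
    (hγ : ∀ u, 0 < γ.eval u) (hdeg : f.natDegree = γ.natDegree) :
    ∃ v v' : DressD, v * v' = 1 ∧ (v : RatFunc ℝ) = φ f / φ γ := by
  refine ⟨⟨_, div_mem_DressD (fun u => (hγ u).ne') hdeg.le⟩,
    ⟨_, div_mem_DressD (fun u => (hf u).ne') hdeg.ge⟩, Subtype.ext ?_, rfl⟩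
  have h1 := map_ne_zero_of_eval_pos hγ
  have h2 := map_ne_zero_of_eval_pos hf
  simp only [Subring.coe_mul, Subring.coe_one]
  field_simp

theorem eval_one_add_X_sq_pow_ne_zero (d : ℕ) (u : ℝ) : ((1 + X ^ 2 : ℝ[X]) ^ d).eval u ≠ 0 :=
  (eval_one_add_X_sq_pow_pos d u).ne'

theorem eval_mul_one_add_X_sq_pow_add_sq_pos {f h : ℝ[X]} (hpos : ∀ u, 0 ≤ f.eval u)
    (hcomax : ∀ u, f.eval u = 0 → h.eval u ≠ 0) (d : ℕ) (u : ℝ) :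
    0 < (f * (1 + X ^ 2) ^ d + h ^ 2).eval u := by
  rw [eval_add, eval_mul, eval_pow (n := 2)]
  have hw := eval_one_add_X_sq_pow_pos d u
  rcases (hpos u).eq_or_lt with h0 | h0
  · rw [← h0, zero_mul, zero_add]
    exact (sq_pos_iff).2 (hcomax u h0.symm)
  · exact add_pos_of_pos_of_nonneg (mul_pos h0 hw) (sq_nonneg _)

theorem isProductOfIdempotents_of_coeff_pos (d : ℕ) {f h : ℝ[X]} (hf : f.natDegree ≤ 2 * d)
    (hh : h.natDegree ≤ 2 * d) (hpos : ∀ u, 0 ≤ f.eval u)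
    (hcomax : ∀ u, f.eval u = 0 → h.eval u ≠ 0)
    (hcoeff : f.coeff (2 * d) ≠ 0 ∨ h.coeff (2 * d) ≠ 0) {p q : DressD}
    (hp : (p : RatFunc ℝ) = φ f / φ ((1 + X ^ 2) ^ d))
    (hq : (q : RatFunc ℝ) = φ h / φ ((1 + X ^ 2) ^ d)) :
    IsProductOfIdempotents !![p, q; 0, 0] := by
  have hwdeg := natDegree_one_add_X_sq_pow d
  have hNpos := eval_mul_one_add_X_sq_pow_add_sq_pos hpos hcomax d
  have hNle : (f * (1 + X ^ 2) ^ d + h ^ 2).natDegree ≤ 2 * d + 2 * d :=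
    natDegree_add_le_of_degree_le (natDegree_mul_le.trans (by omega))
      (natDegree_pow_le.trans (by omega))
  have hNcoeff : (f * (1 + X ^ 2) ^ d + h ^ 2).coeff (2 * d + 2 * d) =
      f.coeff (2 * d) + h.coeff (2 * d) ^ 2 := by
    rw [coeff_add, coeff_mul_add_eq_of_natDegree_le hf hwdeg.le, coeff_one_add_X_sq_pow, mul_one,
      ← two_mul (2 * d), coeff_pow_of_natDegree_le hh]
  have hne : f.coeff (2 * d) + h.coeff (2 * d) ^ 2 ≠ 0 := by
    have h1 := coeff_nonneg_of_eval_nonneg hpos hf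
    rcases hcoeff with h2 | h2
    · have := lt_of_le_of_ne h1 h2.symm
      positivity
    · positivity
  have hNdeg : (f * (1 + X ^ 2) ^ d + h ^ 2).natDegree = 2 * d + 2 * d :=
    le_antisymm hNle (le_natDegree_of_ne_zero (hNcoeff ▸ hne))
  obtain ⟨v, v', hvv, hv⟩ := exists_unit_of_natDegree_eq hNpos
    (eval_one_add_X_sq_pow_pos (2 * d)) (by rw [hNdeg, natDegree_one_add_X_sq_pow]; ring)
  have hw0 := map_ne_zero_of_eval_pos (eval_one_add_X_sq_pow_pos d)
  have e : v = p + q * q := by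
    refine Subtype.ext ?_
    rw [hv, Subring.coe_add, Subring.coe_mul, hp, hq, two_mul, pow_add, map_add, map_mul, map_pow φ h,
      map_mul]
    field_simp
  have key := (isProductOfIdempotents_unit_row hvv q).row_add_left (-q)
  rw [e] at key
  simpa using key

theorem isProductOfIdempotents_of_coeff_odd_ne_zero (d : ℕ) {f h : ℝ[X]}
    (hf : f.natDegree ≤ 2 * d) (hh : h.natDegree ≤ 2 * d + 1) (hpos : ∀ u, 0 ≤ f.eval u)
    (hcomax : ∀ u, f.eval u = 0 → h.eval u ≠ 0) (hcoeff : h.coeff (2 * d + 1) ≠ 0) {p q : DressD}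
    (hp : (p : RatFunc ℝ) = φ f / φ ((1 + X ^ 2) ^ (d + 1)))
    (hq : (q : RatFunc ℝ) = φ h / φ ((1 + X ^ 2) ^ (d + 1))) :
    IsProductOfIdempotents !![p, q; 0, 0] := by
  have hwdeg := natDegree_one_add_X_sq_pow
  have hNpos := eval_mul_one_add_X_sq_pow_add_sq_pos hpos hcomax (d + 1)
  have hNle : (f * (1 + X ^ 2) ^ (d + 1) + h ^ 2).natDegree ≤ 2 * d + 2 * (d + 1) :=
    natDegree_add_le_of_degree_le
      (natDegree_mul_le.trans (add_le_add hf (hwdeg (d + 1)).le))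
      (natDegree_pow_le.trans (by omega))
  have hNcoeff : (f * (1 + X ^ 2) ^ (d + 1) + h ^ 2).coeff (2 * d + 2 * (d + 1)) =
      f.coeff (2 * d) + h.coeff (2 * d + 1) ^ 2 := by
    rw [coeff_add, coeff_mul_add_eq_of_natDegree_le hf (hwdeg (d + 1)).le, coeff_one_add_X_sq_pow,
      mul_one, show 2 * d + 2 * (d + 1) = 2 * (2 * d + 1) by ring, coeff_pow_of_natDegree_le hh]
  have hne : f.coeff (2 * d) + h.coeff (2 * d + 1) ^ 2 ≠ 0 := by
    have h1 := coeff_nonneg_of_eval_nonneg hpos hf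
    positivity
  have hNdeg : (f * (1 + X ^ 2) ^ (d + 1) + h ^ 2).natDegree = 2 * d + 2 * (d + 1) :=
    le_antisymm hNle (le_natDegree_of_ne_zero (hNcoeff ▸ hne))
  obtain ⟨v, v', hvv, hv⟩ := exists_unit_of_natDegree_eq hNpos
    (eval_one_add_X_sq_pow_pos (2 * d + 1)) (by rw [hNdeg, hwdeg]; ring)
  set c := h.coeff (2 * d + 1)
  have hgle : (h - C c * X * (1 + X ^ 2) ^ d).natDegree ≤ 2 * d := by
    have hX : (C c * X : ℝ[X]).natDegree ≤ 1 := by compute_degree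
    have h1 : (h - C c * X * (1 + X ^ 2) ^ d).natDegree ≤ 2 * d + 1 :=
      (natDegree_sub_le _ _).trans (max_le hh (natDegree_mul_le.trans
        ((add_le_add hX (hwdeg d).le).trans (by omega))))
    have h2 : (h - C c * X * (1 + X ^ 2) ^ d).coeff (2 * d + 1) = 0 := by
      rw [coeff_sub, add_comm (2 * d) 1, coeff_mul_add_eq_of_natDegree_le hX (hwdeg d).le,
        coeff_one_add_X_sq_pow, add_comm 1]
      simp [c]
    exact natDegree_le_of_coeff_succ_eq_zero h1 h2
  have hw0 := map_ne_zero_of_eval_pos (eval_one_add_X_sq_pow_pos d)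
  have hw1 := map_ne_zero_of_eval_pos (eval_one_add_X_sq_pow_pos 1)
  rw [pow_one] at hw1
  let r : DressD :=
    ⟨_, div_mem_DressD (eval_one_add_X_sq_pow_ne_zero d) (hgle.trans (hwdeg d).ge)⟩
  let w : DressD := ⟨_, inv_one_add_sq_mem_DressD (φ X)⟩
  let y : DressD := ⟨_, div_one_add_sq_mem_DressD (φ X)⟩
  have hsq : φ (1 + X ^ 2) = 1 + φ X ^ 2 := by simp
  rw [hsq] at hw1
  have hwy : w * (1 - w) = y * y := by
    refine Subtype.ext ?_
    simp only [w, y, Subring.coe_mul, AddSubgroupClass.coe_sub, Subring.coe_one]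
    field_simp
    ring
  have hcc : (⟨_, C_mem_DressD c⟩ : DressD) * ⟨_, C_mem_DressD c⁻¹⟩ = 1 := by
    refine Subtype.ext ?_
    rw [Subring.coe_mul, ← map_mul, ← C_mul, mul_inv_cancel₀ hcoeff]
    simp
  have e1 : v * w = p + q * q := by
    refine Subtype.ext ?_
    rw [Subring.coe_mul, Subring.coe_add, Subring.coe_mul, hv, hp, hq]
    simp only [w, map_add, map_mul, map_pow, map_one] at hw0 ⊢
    field_simp
    ring
  have e2 : ⟨_, C_mem_DressD c⟩ * y + r * v' * (v * w) = q := by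
    rw [show r * v' * (v * w) = r * w by linear_combination r * w * hvv]
    refine Subtype.ext ?_
    rw [Subring.coe_add, Subring.coe_mul, Subring.coe_mul, hq]
    simp only [r, w, y, map_add, map_sub, map_mul, map_pow, map_one] at hw0 ⊢
    field_simp
    ring
  have key := ((isProductOfIdempotents_unit_mul_row hvv hcc hwy).row_add_right (r * v'))
  rw [e2, e1] at key
  simpa using key.row_add_left (-q)

theorem isProductOfIdempotents_of_pow (d : ℕ) (f h : ℝ[X]) (hf : f.natDegree ≤ 2 * d)
    (hh : h.natDegree ≤ 2 * d) (hpos : ∀ u, 0 ≤ f.eval u)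
    (hcomax : ∀ u, f.eval u = 0 → h.eval u ≠ 0) (p q : DressD)
    (hp : (p : RatFunc ℝ) = φ f / φ ((1 + X ^ 2) ^ d))
    (hq : (q : RatFunc ℝ) = φ h / φ ((1 + X ^ 2) ^ d)) :
    IsProductOfIdempotents !![p, q; 0, 0] := by
  induction d generalizing p q with
  | zero =>
    refine isProductOfIdempotents_of_coeff_pos 0 hf hh hpos hcomax ?_ hp hq
    by_contra! h0
    rw [eq_C_of_natDegree_le_zero hf, eq_C_of_natDegree_le_zero hh] at hcomax
    exact hcomax 0 (by simpa using h0.1) (by simpa using h0.2)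
  | succ d ih =>
    by_cases hcoeff : f.coeff (2 * (d + 1)) ≠ 0 ∨ h.coeff (2 * (d + 1)) ≠ 0
    · exact isProductOfIdempotents_of_coeff_pos (d + 1) hf hh hpos hcomax hcoeff hp hq
    push Not at hcoeff
    have hf1 : f.natDegree ≤ 2 * d + 1 := natDegree_le_of_coeff_succ_eq_zero hf hcoeff.1
    have hh1 : h.natDegree ≤ 2 * d + 1 := natDegree_le_of_coeff_succ_eq_zero hh hcoeff.2
    obtain ⟨k, hk⟩ := even_natDegree_of_eval_nonneg hpos
    have hf2 : f.natDegree ≤ 2 * d := by omega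
    by_cases hodd : h.coeff (2 * d + 1) = 0
    · have hh2 : h.natDegree ≤ 2 * d := natDegree_le_of_coeff_succ_eq_zero hh1 hodd
      have hwdeg := natDegree_one_add_X_sq_pow d
      have key := (ih hf2 hh2
        ⟨_, div_mem_DressD (eval_one_add_X_sq_pow_ne_zero d) (hf2.trans hwdeg.ge)⟩
        ⟨_, div_mem_DressD (eval_one_add_X_sq_pow_ne_zero d) (hh2.trans hwdeg.ge)⟩
        rfl rfl).row_smul ⟨_, inv_one_add_sq_mem_DressD (φ X)⟩
      have e : ∀ g : ℝ[X], φ g / φ ((1 + X ^ 2) ^ (d + 1)) =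
          (1 + φ X ^ 2)⁻¹ * (φ g / φ ((1 + X ^ 2) ^ d)) := fun g => by
        rw [pow_succ, map_mul, div_mul_eq_div_div, map_add, map_one, map_pow φ X, mul_comm,
          div_eq_mul_inv (_ / _)]
      convert key using 4
      · exact Subtype.ext (hp.trans (e f))
      · congr 1
        exact Subtype.ext (hq.trans (e h))
    · exact isProductOfIdempotents_of_coeff_odd_ne_zero d hf2 hh1 hpos hcomax hodd hp hq

theorem isProductOfIdempotents_of_nonneg (p q : DressD)
    (hcomax : ¬∃ u : ℝ, evalD p u = 0 ∧ evalD q u = 0) (hpos : ∀ u : ℝ, 0 ≤ evalD p u) :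
    IsProductOfIdempotents !![p, q; 0, 0] := by
  obtain ⟨f, γ, hγ, hf, hp⟩ := exists_eq_div_of_mem_DressD p.2
  obtain ⟨g, δ, hδ, hg, hq⟩ := exists_eq_div_of_mem_DressD q.2
  have hγδ : ∀ u, 0 < (γ * δ).eval u := fun u => by rw [eval_mul]; exact mul_pos (hγ u) (hδ u)
  have hdeg : (γ * δ).natDegree = γ.natDegree + δ.natDegree :=
    natDegree_mul (ne_zero_of_eval_pos hγ) (ne_zero_of_eval_pos hδ)
  have h1 := map_ne_zero_of_eval_pos hγ
  have h2 := map_ne_zero_of_eval_pos hδ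
  obtain ⟨d, hd⟩ := even_natDegree_of_eval_nonneg fun u => (hγδ u).le
  have hf' : (f * δ).natDegree ≤ 2 * d := natDegree_mul_le.trans (by omega)
  have hg' : (g * γ).natDegree ≤ 2 * d := natDegree_mul_le.trans (by omega)
  have hw := eval_one_add_X_sq_pow_pos d
  have hw0 := map_ne_zero_of_eval_pos hw
  have hwdeg := natDegree_one_add_X_sq_pow d
  obtain ⟨v, v', -, hv⟩ := exists_unit_of_natDegree_eq hw hγδ (by omega)
  have key := isProductOfIdempotents_of_pow d (f * δ) (g * γ) hf' hg'
    (fun u => by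
      rw [eval_mul, ← evalD_mul_eval hγ hp]
      exact mul_nonneg (mul_nonneg (hpos u) (hγ u).le) (hδ u).le)
    (fun u => by
      rw [eval_mul, eval_mul, ← evalD_mul_eval hγ hp, ← evalD_mul_eval hδ hq]
      intro h0 h3
      refine hcomax ⟨u, ?_, ?_⟩
      · simpa [(hγ u).ne', (hδ u).ne'] using h0
      · simpa [(hγ u).ne', (hδ u).ne'] using h3)
    ⟨_, div_mem_DressD (fun u => (hw u).ne') (hf'.trans hwdeg.ge)⟩
    ⟨_, div_mem_DressD (fun u => (hw u).ne') (hg'.trans hwdeg.ge)⟩ rfl rfl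
  convert key.row_smul v using 4
  · refine Subtype.ext ?_
    simp only [Subring.coe_mul, hv, hp, map_mul]
    field_simp
  · congr 1
    refine Subtype.ext ?_
    simp only [Subring.coe_mul, hv, hq, map_mul]
    field_simp

end DressRing

theorem stmt_6 (p q : DressD)
    (hcomax : ¬∃ u : ℝ, evalD p u = 0 ∧ evalD q u = 0)
    (hpos : (∀ u : ℝ, 0 ≤ evalD p u) ∨ (∀ u : ℝ, 0 ≤ evalD q u)) :
    IsProductOfIdempotents (!![p, q; 0, 0] : Matrix (Fin 2) (Fin 2) DressD) := by
  rcases hpos with h | h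
  · exact isProductOfIdempotents_of_nonneg p q hcomax h
  · exact (isProductOfIdempotents_of_nonneg q p (fun ⟨u, h1, h2⟩ => hcomax ⟨u, h2, h1⟩) h).row_swap
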